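/- arXiv:1803.00715 — 2 statements merged into one kernel-verified Lean document; each statement's English description precedes it below -/
import Mathlib

section
/- For every integer d ≥ 1 and all nonzero vectors U1, U2 ∈ ℝ^d, one has ∫_{S^{d−1}} 1(⟨β,U1⟩ ≤ 0)·1(⟨β,U2⟩ ≤ 0) dλ(β) = 1/2 − (1/(2π))·Ang(U1,U2). -/
open MeasureTheory ProbabilityTheory Real
open scoped RealInnerProductSpace ENNReal BigOperators

noncomputable section

/-- The standard Gaussian measure on `ℝ^d = EuclideanSpace ℝ (Fin d)`. -/
def stdGaussian (d : ℕ) : Measure (EuclideanSpace ℝ (Fin d)) :=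
  (Measure.pi fun _ : Fin d => gaussianReal 0 1).map
    ⇑(EuclideanSpace.equiv (Fin d) ℝ).symm

/-- The uniform (rotation-invariant) probability measure `λ` on the unit sphere
`S^{d-1} = {x : ‖x‖ = 1} ⊆ ℝ^d`, realized as a Borel measure on `ℝ^d` concentrated
on the sphere: the pushforward of the standard Gaussian under `x ↦ ‖x‖⁻¹ • x`. -/
def sphereUniform (d : ℕ) : Measure (EuclideanSpace ℝ (Fin d)) :=
  (stdGaussian d).map fun x => ‖x‖⁻¹ • x

/-- `Ang u v = arccos (⟪u,v⟫ / (‖u‖ ‖v‖)) ∈ [0, π]`, the angle between two nonzero vectors. -/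
def Ang {d : ℕ} (u v : EuclideanSpace ℝ (Fin d)) : ℝ :=
  Real.arccos (⟪u, v⟫ / (‖u‖ * ‖v‖))


lemma std_eq (d : ℕ) : _root_.stdGaussian d
    = ProbabilityTheory.stdGaussian (EuclideanSpace ℝ (Fin d)) := by
  rw [← map_pi_eq_stdGaussian]; rfl

lemma charFunDual_gauss (L : StrongDual ℝ ℝ) :
    charFunDual (gaussianReal 0 1) L = Complex.exp (-(L 1)^2 / 2) := by
  have h : charFunDual (gaussianReal 0 1) L = charFun (gaussianReal 0 1) (L 1) := by
    rw [charFunDual_apply, charFun_apply]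
    congr 1; ext x
    have : L x = x * L 1 := by
      rw [← smul_eq_mul, ← map_smul]; simp
    rw [this]; simp [mul_comm]
  rw [h, charFun_gaussianReal]
  congr 1
  push_cast
  ring

lemma joint_law {d : ℕ} (u v : EuclideanSpace ℝ (Fin d)) (a : ℝ)
    (hu : ‖u‖ = 1) (hv : ‖v‖ = 1) (huv : ⟪u, v⟫ = cos (2 * a)) :
    (_root_.stdGaussian d).map (fun x => (⟪x, u⟫, ⟪x, v⟫)) =
    ((gaussianReal 0 1).prod (gaussianReal 0 1)).map
      (fun p : ℝ × ℝ => (-(p.1 * cos a + p.2 * sin a), -(p.1 * cos a - p.2 * sin a))) := by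
  rw [std_eq]
  have hp1 : IsProbabilityMeasure ((ProbabilityTheory.stdGaussian (EuclideanSpace ℝ (Fin d))).map
      (fun x => (⟪x, u⟫, ⟪x, v⟫))) := Measure.isProbabilityMeasure_map (by fun_prop)
  have hp2 : IsProbabilityMeasure (((gaussianReal 0 1).prod (gaussianReal 0 1)).map
      (fun p : ℝ × ℝ => (-(p.1 * cos a + p.2 * sin a), -(p.1 * cos a - p.2 * sin a)))) :=
    Measure.isProbabilityMeasure_map (by fun_prop)
  apply Measure.ext_of_charFunDual
  ext L
  have hL : ∀ x y : ℝ, L (x, y) = x * L (1, 0) + y * L (0, 1) := by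
    intro x y
    rw [← smul_eq_mul, ← smul_eq_mul, ← map_smul, ← map_smul, ← map_add]; simp
  have e1 : charFunDual ((ProbabilityTheory.stdGaussian (EuclideanSpace ℝ (Fin d))).map
      (fun x => (⟪x, u⟫, ⟪x, v⟫))) L
      = charFun (ProbabilityTheory.stdGaussian (EuclideanSpace ℝ (Fin d)))
        (L (1, 0) • u + L (0, 1) • v) := by
    rw [charFunDual_apply, charFun_apply, integral_map (by fun_prop)
      (Measurable.aestronglyMeasurable (by fun_prop))]
    congr 1; ext x
    rw [hL, inner_add_right, real_inner_smul_right, real_inner_smul_right]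
    ring_nf
  let M : ℝ × ℝ →L[ℝ] ℝ := (-(L (1,0) * cos a + L (0,1) * cos a)) • ContinuousLinearMap.fst ℝ ℝ ℝ
    + (-(L (1,0) * sin a - L (0,1) * sin a)) • ContinuousLinearMap.snd ℝ ℝ ℝ
  have e2 : charFunDual (((gaussianReal 0 1).prod (gaussianReal 0 1)).map
      (fun p : ℝ × ℝ => (-(p.1 * cos a + p.2 * sin a), -(p.1 * cos a - p.2 * sin a)))) L
      = charFunDual ((gaussianReal 0 1).prod (gaussianReal 0 1)) M := by
    rw [charFunDual_apply, charFunDual_apply, integral_map (by fun_prop)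
      (Measurable.aestronglyMeasurable (by fun_prop))]
    congr 1; ext x
    rw [hL]
    have : M x = (-(L (1,0) * cos a + L (0,1) * cos a)) * x.1
      + (-(L (1,0) * sin a - L (0,1) * sin a)) * x.2 := by simp [M]
    rw [this]
    ring_nf
  rw [e1, e2, charFun_stdGaussian, charFunDual_prod, charFunDual_gauss, charFunDual_gauss,
    ← Complex.exp_add]
  congr 1
  have n : ‖L (1, 0) • u + L (0, 1) • v‖ ^ 2 =
      L (1,0) ^ 2 + 2 * (L (1,0) * L (0,1) * cos (2 * a)) + L (0,1) ^ 2 := by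
    rw [norm_add_sq_real, real_inner_smul_left, real_inner_smul_right, huv, norm_smul, norm_smul,
      hu, hv]
    simp; ring
  have m1 : (M.comp (ContinuousLinearMap.inl ℝ ℝ ℝ)) 1
      = -(L (1,0) * cos a + L (0,1) * cos a) := by simp [M]
  have m2 : (M.comp (ContinuousLinearMap.inr ℝ ℝ ℝ)) 1
      = -(L (1,0) * sin a - L (0,1) * sin a) := by simp [M]
  rw [m1, m2, ← Complex.ofReal_pow, n]
  norm_cast
  have hs : sin a ^ 2 = 1 - cos a ^ 2 := by rw [sin_sq]
  rw [cos_two_mul]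
  linear_combination (1/2 : ℝ) * (L (1,0) - L (0,1))^2 * hs

def Kc : ℝ≥0∞ := ∫⁻ r in Set.Ioi (0:ℝ), ENNReal.ofReal r * ENNReal.ofReal ((2*π)⁻¹ * exp (-r^2/2))

lemma polar_meas (S : Set (ℝ × ℝ)) (hS : MeasurableSet S) (A : Set ℝ) (hA : MeasurableSet A)
    (h : ∀ r φ : ℝ, 0 < r → -π < φ → φ < π → ((r * cos φ, r * sin φ) ∈ S ↔ φ ∈ A)) :
    ((gaussianReal 0 1).prod (gaussianReal 0 1)) S = Kc * volume (A ∩ Set.Ioo (-π) π) := by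
  rw [gaussianReal_of_var_ne_zero _ one_ne_zero,
    prod_withDensity (measurable_gaussianPDF _ _) (measurable_gaussianPDF _ _),
    withDensity_apply _ hS, ← lintegral_indicator hS, ← Measure.volume_eq_prod,
    ← lintegral_comp_polarCoord_symm]
  have : ∀ p ∈ polarCoord.target, ENNReal.ofReal p.1 •
      S.indicator (fun a : ℝ × ℝ => gaussianPDF 0 1 a.1 * gaussianPDF 0 1 a.2) (polarCoord.symm p)
      = (ENNReal.ofReal p.1 * ENNReal.ofReal ((2*π)⁻¹ * exp (-p.1^2/2)))
        * A.indicator 1 p.2 := by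
    rintro ⟨r, φ⟩ hp
    simp only [polarCoord_target, Set.mem_prod, Set.mem_Ioi, Set.mem_Ioo] at hp
    have hh := h r φ hp.1 hp.2.1 hp.2.2
    simp only [polarCoord_symm_apply, smul_eq_mul]
    by_cases hφ : φ ∈ A
    · rw [Set.indicator_of_mem (hh.2 hφ), Set.indicator_of_mem hφ]
      simp only [Pi.one_apply, mul_one]
      congr 1
      rw [gaussianPDF, gaussianPDF, ← ENNReal.ofReal_mul (gaussianPDFReal_nonneg _ _ _)]
      congr 1
      simp only [gaussianPDFReal, NNReal.coe_one, mul_one, sub_zero]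
      rw [mul_mul_mul_comm, ← exp_add, ← mul_inv, mul_self_sqrt (by positivity)]
      congr 2
      linear_combination (-r^2/2) * (cos_sq_add_sin_sq φ)
    · rw [Set.indicator_of_notMem (fun h' => hφ (hh.1 h')), Set.indicator_of_notMem hφ]
      simp
  rw [setLIntegral_congr_fun polarCoord.open_target.measurableSet this, polarCoord_target,
    Measure.volume_eq_prod, ← Measure.prod_restrict,
    lintegral_prod_mul
      (f := fun r : ℝ => ENNReal.ofReal r * ENNReal.ofReal ((2*π)⁻¹ * exp (-r^2/2)))
      (g := A.indicator 1) (by fun_prop) (by exact (measurable_one.indicator hA).aemeasurable)]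
  rw [lintegral_indicator_one hA, Measure.restrict_apply hA]
  rfl

lemma Kc_eq : Kc = ENNReal.ofReal (1 / (2 * π)) := by
  have := polar_meas Set.univ MeasurableSet.univ Set.univ MeasurableSet.univ (by simp)
  simp only [measure_univ, Set.univ_inter, Real.volume_Ioo] at this
  rw [one_div, ENNReal.ofReal_inv_of_pos (by positivity)]
  apply ENNReal.eq_inv_of_mul_eq_one_left
  rw [this]; congr 2; ring

lemma wedge (a : ℝ) (h0 : 0 ≤ a) (h1 : a ≤ π / 2) :
    ((gaussianReal 0 1).prod (gaussianReal 0 1))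
      {p | -(p.1 * cos a + p.2 * sin a) ≤ 0 ∧ -(p.1 * cos a - p.2 * sin a) ≤ 0}
      = ENNReal.ofReal (1 / 2 - 2 * a / (2 * π)) := by
  have hpi := Real.pi_pos
  rw [polar_meas _ ?_ (Set.Icc (-(π/2-a)) (π/2-a)) measurableSet_Icc ?_, Kc_eq]
  · have hv : volume (Set.Icc (-(π/2-a)) (π/2-a) ∩ Set.Ioo (-π) π) = ENNReal.ofReal (π - 2 * a) := by
      by_cases ha : a = 0 ∨ 0 < a
      · rw [Set.inter_eq_left.2, Real.volume_Icc]
        · congr 1; ring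
        · intro x hx
          exact ⟨by linarith [hx.1], by linarith [hx.2]⟩
      · exact absurd (h0.eq_or_lt.imp Eq.symm id) ha
    rw [hv, ← ENNReal.ofReal_mul (by positivity)]
    congr 1
    field_simp
  · rw [Set.ofPred_and]
    exact (measurableSet_le (by fun_prop) (by fun_prop)).inter
      (measurableSet_le (by fun_prop) (by fun_prop))
  · intro r φ hr hl hu
    have e1 : -(r * cos φ * cos a + r * sin φ * sin a) ≤ 0 ↔ 0 ≤ cos (φ - a) := by
      rw [cos_sub, ← mul_nonneg_iff_of_pos_left hr, neg_nonpos]; ring_nf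
    have e2 : -(r * cos φ * cos a - r * sin φ * sin a) ≤ 0 ↔ 0 ≤ cos (φ + a) := by
      rw [cos_add, ← mul_nonneg_iff_of_pos_left hr, neg_nonpos]; ring_nf
    simp only [Set.mem_ofPred_eq, e1, e2, Set.mem_Icc]
    constructor
    · rintro ⟨p, q⟩
      constructor
      · by_contra! hc
        have := cos_neg_of_pi_div_two_lt_of_lt (x := -(φ - a)) (by linarith) (by linarith)
        rw [cos_neg] at this
        linarith
      · by_contra! hc
        have := cos_neg_of_pi_div_two_lt_of_lt (x := φ + a) (by linarith) (by linarith)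
        linarith
    · rintro ⟨p, q⟩
      exact ⟨cos_nonneg_of_neg_pi_div_two_le_of_le (by linarith) (by linarith),
        cos_nonneg_of_neg_pi_div_two_le_of_le (by linarith) (by linarith)⟩

/-- Escanciano's lemma: for `d ≥ 1` and nonzero `U₁, U₂ ∈ ℝ^d`,
`∫_{S^{d-1}} 1(⟪β,U₁⟫ ≤ 0) · 1(⟪β,U₂⟫ ≤ 0) dλ(β) = 1/2 - Ang(U₁,U₂)/(2π)`. -/
theorem stmt0 {d : ℕ} (hd : 1 ≤ d) (U1 U2 : EuclideanSpace ℝ (Fin d))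
    (h1 : U1 ≠ 0) (h2 : U2 ≠ 0) :
    (∫ β, (if ⟪β, U1⟫ ≤ 0 then (1 : ℝ) else 0) * (if ⟪β, U2⟫ ≤ 0 then (1 : ℝ) else 0)
        ∂(sphereUniform d))
      = 1 / 2 - Ang U1 U2 / (2 * π) := by
  have n1 : 0 < ‖U1‖ := norm_pos_iff.2 h1
  have n2 : 0 < ‖U2‖ := norm_pos_iff.2 h2
  set u := ‖U1‖⁻¹ • U1 with hu
  set v := ‖U2‖⁻¹ • U2 with hv
  have nu : ‖u‖ = 1 := by rw [hu, norm_smul, norm_inv, norm_norm, inv_mul_cancel₀ n1.ne']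
  have nv : ‖v‖ = 1 := by rw [hv, norm_smul, norm_inv, norm_norm, inv_mul_cancel₀ n2.ne']
  have ang : Ang U1 U2 = arccos ⟪u, v⟫ := by
    rw [Ang, hu, hv, real_inner_smul_left, real_inner_smul_right]
    congr 1
    field_simp
  have huv : ⟪u, v⟫ = cos (2 * (Ang U1 U2 / 2)) := by
    have hb := abs_le.1 (abs_real_inner_le_norm u v)
    rw [nu, nv] at hb
    rw [ang, mul_div_cancel₀ _ two_ne_zero, cos_arccos (by linarith [hb.1]) (by linarith [hb.2])]
  have key : ∀ x : EuclideanSpace ℝ (Fin d),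
      (if ⟪‖x‖⁻¹ • x, U1⟫ ≤ 0 then (1 : ℝ) else 0) * (if ⟪‖x‖⁻¹ • x, U2⟫ ≤ 0 then (1 : ℝ) else 0)
      = Set.indicator ((fun x => (⟪x, u⟫, ⟪x, v⟫)) ⁻¹' {p : ℝ × ℝ | p.1 ≤ 0 ∧ p.2 ≤ 0}) 1 x := by
    intro x
    have aux : ∀ U : EuclideanSpace ℝ (Fin d), U ≠ 0 →
        (⟪‖x‖⁻¹ • x, U⟫ ≤ 0 ↔ ⟪x, ‖U‖⁻¹ • U⟫ ≤ 0) := by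
      intro U hU
      rcases eq_or_ne x 0 with rfl | hx
      · simp
      · have hU' : 0 < ‖U‖⁻¹ := inv_pos.2 (norm_pos_iff.2 hU)
        have hx' : 0 < ‖x‖⁻¹ := inv_pos.2 (norm_pos_iff.2 hx)
        rw [real_inner_smul_left, real_inner_smul_right, mul_nonpos_iff_pos_imp_nonpos,
          mul_nonpos_iff_pos_imp_nonpos]
        constructor
        · intro h; exact ⟨fun _ => h.1 hx', fun _ => hU'.le⟩
        · intro h; exact ⟨fun _ => h.1 hU', fun _ => hx'.le⟩
    simp only [aux U1 h1, aux U2 h2, Set.indicator, Set.mem_preimage, Set.mem_ofPred_eq,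
      Pi.one_apply, ← hu, ← hv]
    by_cases c1 : ⟪x, u⟫ ≤ 0 <;> by_cases c2 : ⟪x, v⟫ ≤ 0 <;> simp [c1, c2]
  have hm : MeasurableSet {p : ℝ × ℝ | p.1 ≤ 0 ∧ p.2 ≤ 0} := by
    rw [Set.ofPred_and]
    exact (measurableSet_le (by fun_prop) (by fun_prop)).inter
      (measurableSet_le (by fun_prop) (by fun_prop))
  have mT : Measurable (fun x : EuclideanSpace ℝ (Fin d) => (⟪x, u⟫, ⟪x, v⟫)) := by fun_prop
  rw [sphereUniform, integral_map (by fun_prop) ?_]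
  · simp_rw [key]
    rw [integral_indicator_one (mT hm), measureReal_def, ← Measure.map_apply mT hm,
      joint_law u v _ nu nv huv, Measure.map_apply (by fun_prop) hm]
    have hw := wedge (Ang U1 U2 / 2) (by have := arccos_nonneg ⟪u, v⟫; linarith)
      (by have := arccos_le_pi ⟪u, v⟫; linarith)
    have : (1:ℝ) / 2 - 2 * (Ang U1 U2 / 2) / (2 * π) = 1 / 2 - Ang U1 U2 / (2 * π) := by ring
    rw [this] at hw
    refine (congrArg ENNReal.toReal hw).trans (ENNReal.toReal_ofReal ?_)
    have := arccos_le_pi ⟪u, v⟫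
    rw [← ang] at this
    have hpi := Real.pi_pos
    rw [sub_nonneg, div_le_div_iff₀ (by positivity) (by positivity)]
    linarith
  · apply Measurable.aestronglyMeasurable
    exact (Measurable.ite (measurableSet_le (by fun_prop) (by fun_prop)) (by fun_prop)
      (by fun_prop)).mul (Measurable.ite (measurableSet_le (by fun_prop) (by fun_prop))
      (by fun_prop) (by fun_prop))
end
end

section
/- For all Borel probability measures P, Q on ℝ^d and every weight ϑ ∈ (0,1), the squared Cramér–von Mises distance satisfies W_d²(P,Q) ≥ 0, and W_d(P,Q) = 0 if and only if P = Q. -/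
open MeasureTheory ProbabilityTheory Real
open scoped RealInnerProductSpace ENNReal BigOperators

noncomputable section

/-- Law of the projection `x ↦ ⟪β, x⟫` under `P`. -/
def projLaw {d : ℕ} (P : Measure (EuclideanSpace ℝ (Fin d)))
    (β : EuclideanSpace ℝ (Fin d)) : Measure ℝ :=
  P.map fun x => ⟪β, x⟫

/-- `F_{β,P}(t) = P {x : ⟪β,x⟫ ≤ t}`. -/
def projCDF {d : ℕ} (P : Measure (EuclideanSpace ℝ (Fin d)))
    (β : EuclideanSpace ℝ (Fin d)) (t : ℝ) : ℝ :=
  (P {x | ⟪β, x⟫ ≤ t}).toReal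

/-- The squared Cramér–von Mises distance `W_d²(P,Q)` with weight `ϑ`:
`∫_{S^{d-1}} ∫_ℝ (F_{β,P}(t) - F_{β,Q}(t))² dH_β(t) dλ(β)` where `H_β` is the law of
`x ↦ ⟪β,x⟫` under the mixture `ϑ•P + (1-ϑ)•Q`. -/
def cvmSq {d : ℕ} (ϑ : ℝ) (P Q : Measure (EuclideanSpace ℝ (Fin d))) : ℝ :=
  ∫ β, (∫ t, (projCDF P β t - projCDF Q β t) ^ 2
      ∂(projLaw (ENNReal.ofReal ϑ • P + ENNReal.ofReal (1 - ϑ) • Q) β))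
    ∂(sphereUniform d)

/-- The continuity assumption: for `λ`-a.e. `β`, the pushforwards of `P` and `Q`
under `x ↦ ⟪β,x⟫` are atomless. -/
def ContinuityAssumption {d : ℕ} (P Q : Measure (EuclideanSpace ℝ (Fin d))) : Prop :=
  ∀ᵐ β ∂(sphereUniform d),
    (∀ t : ℝ, projLaw P β {t} = 0) ∧ (∀ t : ℝ, projLaw Q β {t} = 0)

lemma aux_seq (A : Set ℝ) (t : ℝ) (h : (A ∩ Set.Iic t).Nonempty) :
    ∃ u : ℕ → ℝ, Monotone u ∧ (∀ n, u n ∈ A) ∧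
      ∀ μ : Measure ℝ, μ Aᶜ = 0 → μ (Set.Iic t) = ⨆ n, μ (Set.Iic (u n)) := by
  have hb : BddAbove (A ∩ Set.Iic t) := ⟨t, fun x hx => hx.2⟩
  have hl := isLUB_csSup h hb
  have key : ∃ u : ℕ → ℝ, Monotone u ∧ (∀ n, u n ∈ A ∩ Set.Iic t) ∧
      A ∩ Set.Iic t ⊆ ⋃ n, Set.Iic (u n) := by
    by_cases hs : sSup (A ∩ Set.Iic t) ∈ A ∩ Set.Iic t
    · refine ⟨fun _ => sSup (A ∩ Set.Iic t), monotone_const, fun _ => hs, fun x hx => ?_⟩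
      exact Set.mem_iUnion.2 ⟨0, hl.1 hx⟩
    · obtain ⟨u, hu, -, hlim, hmem⟩ := hl.exists_seq_monotone_tendsto h
      refine ⟨u, hu, hmem, fun x hx => ?_⟩
      have hlt : x < sSup (A ∩ Set.Iic t) :=
        lt_of_le_of_ne (hl.1 hx) (fun e => hs (e ▸ hx))
      obtain ⟨n, hn⟩ := (hlim.eventually (lt_mem_nhds hlt)).exists
      exact Set.mem_iUnion.2 ⟨n, hn.le⟩
  obtain ⟨u, hu, hmem, hsub⟩ := key
  refine ⟨u, hu, fun n => (hmem n).1, fun μ hμ => ?_⟩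
  have hm : Monotone fun n => Set.Iic (u n) := fun i j hij => Set.Iic_subset_Iic.2 (hu hij)
  rw [← hm.measure_iUnion]
  apply le_antisymm
  · calc μ (Set.Iic t) ≤ μ ((⋃ n, Set.Iic (u n)) ∪ Aᶜ) := by
          apply measure_mono
          intro x hx
          by_cases hA : x ∈ A
          · exact Or.inl (hsub ⟨hA, hx⟩)
          · exact Or.inr hA
      _ ≤ μ (⋃ n, Set.Iic (u n)) + μ Aᶜ := measure_union_le _ _
      _ = _ := by rw [hμ, add_zero]
  · exact measure_mono (Set.iUnion_subset fun n => Set.Iic_subset_Iic.2 (hmem n).2)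

lemma aux_oneDim (μ ν : Measure ℝ) [IsProbabilityMeasure μ] [IsProbabilityMeasure ν]
    (h1 : ∀ᵐ t ∂μ, μ (Set.Iic t) = ν (Set.Iic t))
    (h2 : ∀ᵐ t ∂ν, μ (Set.Iic t) = ν (Set.Iic t)) : μ = ν := by
  apply Measure.ext_of_Iic
  intro t
  set A : Set ℝ := {t | μ (Set.Iic t) = ν (Set.Iic t)} with hA
  have h1' : μ Aᶜ = 0 := h1
  have h2' : ν Aᶜ = 0 := h2
  by_cases h : (A ∩ Set.Iic t).Nonempty
  · obtain ⟨u, -, huA, hu⟩ := aux_seq A t h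
    rw [hu μ h1', hu ν h2']
    exact iSup_congr huA
  · have hsub : Set.Iic t ⊆ Aᶜ := fun x hx hxA => h ⟨x, hxA, hx⟩
    rw [measure_mono_null hsub h1', measure_mono_null hsub h2']

lemma aux_cdf {d : ℕ} (P : Measure (EuclideanSpace ℝ (Fin d))) (β : EuclideanSpace ℝ (Fin d)) (t : ℝ) :
    projCDF P β t = (projLaw P β (Set.Iic t)).toReal := by
  unfold projCDF projLaw
  rw [Measure.map_apply (by fun_prop) measurableSet_Iic]
  rfl

lemma aux_cdf_meas {d : ℕ} (P : Measure (EuclideanSpace ℝ (Fin d))) [IsProbabilityMeasure P] :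
    Measurable fun p : EuclideanSpace ℝ (Fin d) × ℝ => projCDF P p.1 p.2 := by
  unfold projCDF
  apply Measurable.ennreal_toReal
  have hs : MeasurableSet {q : (EuclideanSpace ℝ (Fin d) × ℝ) × EuclideanSpace ℝ (Fin d) |
      ⟪q.1.1, q.2⟫ ≤ q.1.2} := by
    apply measurableSet_le <;> fun_prop
  exact measurable_measure_prodMk_left (ν := P) hs

lemma aux_bound {d : ℕ} (P Q : Measure (EuclideanSpace ℝ (Fin d))) [IsProbabilityMeasure P]
    [IsProbabilityMeasure Q] (β : EuclideanSpace ℝ (Fin d)) (t : ℝ) :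
    ‖(projCDF P β t - projCDF Q β t) ^ 2‖ ≤ 1 := by
  have h1 : 0 ≤ projCDF P β t := ENNReal.toReal_nonneg
  have h2 : 0 ≤ projCDF Q β t := ENNReal.toReal_nonneg
  have h3 : projCDF P β t ≤ 1 := measureReal_le_one
  have h4 : projCDF Q β t ≤ 1 := measureReal_le_one
  rw [Real.norm_eq_abs, abs_le]
  constructor <;> nlinarith

lemma aux_proj_eq {d : ℕ} (P Q : Measure (EuclideanSpace ℝ (Fin d))) [IsProbabilityMeasure P]
    [IsProbabilityMeasure Q] (ϑ : ℝ) (hϑ : ϑ ∈ Set.Ioo (0 : ℝ) 1) (β : EuclideanSpace ℝ (Fin d))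
    (h : ∫ t, (projCDF P β t - projCDF Q β t) ^ 2
      ∂(projLaw (ENNReal.ofReal ϑ • P + ENNReal.ofReal (1 - ϑ) • Q) β) = 0) :
    projLaw P β = projLaw Q β := by
  have hm : Measurable fun x : EuclideanSpace ℝ (Fin d) => ⟪β, x⟫ := by fun_prop
  have hP : IsProbabilityMeasure (projLaw P β) := Measure.isProbabilityMeasure_map hm.aemeasurable
  have hQ : IsProbabilityMeasure (projLaw Q β) := Measure.isProbabilityMeasure_map hm.aemeasurable
  have hE : projLaw (ENNReal.ofReal ϑ • P + ENNReal.ofReal (1 - ϑ) • Q) β =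
      ENNReal.ofReal ϑ • projLaw P β + ENNReal.ofReal (1 - ϑ) • projLaw Q β := by
    unfold projLaw
    rw [Measure.map_add _ _ hm, Measure.map_smul, Measure.map_smul]
  rw [hE] at h
  have hf : Measurable fun t => (projCDF P β t - projCDF Q β t) ^ 2 :=
    (((aux_cdf_meas P).comp measurable_prodMk_left).sub
      ((aux_cdf_meas Q).comp measurable_prodMk_left)).pow_const 2
  have hfin : IsFiniteMeasure
      (ENNReal.ofReal ϑ • projLaw P β + ENNReal.ofReal (1 - ϑ) • projLaw Q β) := by
    have := Measure.smul_finite (projLaw P β) (c := ENNReal.ofReal ϑ) ENNReal.ofReal_ne_top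
    have := Measure.smul_finite (projLaw Q β) (c := ENNReal.ofReal (1 - ϑ)) ENNReal.ofReal_ne_top
    infer_instance
  have hi : Integrable (fun t => (projCDF P β t - projCDF Q β t) ^ 2)
      (ENNReal.ofReal ϑ • projLaw P β + ENNReal.ofReal (1 - ϑ) • projLaw Q β) :=
    Integrable.of_bound hf.aestronglyMeasurable 1 (Filter.Eventually.of_forall (aux_bound P Q β))
  rw [integral_eq_zero_iff_of_nonneg (fun t => sq_nonneg _) hi, Filter.EventuallyEq,
    ae_add_measure_iff, Measure.ae_ennreal_smul_measure_iff,
    Measure.ae_ennreal_smul_measure_iff] at h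
  · have conv : ∀ t, (projCDF P β t - projCDF Q β t) ^ 2 = (0 : ℝ → ℝ) t →
        projLaw P β (Set.Iic t) = projLaw Q β (Set.Iic t) := by
      intro t ht
      have : projCDF P β t = projCDF Q β t := by
        simpa [sub_eq_zero] using ht
      rw [aux_cdf, aux_cdf] at this
      exact (ENNReal.toReal_eq_toReal_iff' (measure_ne_top _ _) (measure_ne_top _ _)).1 this
    exact aux_oneDim _ _ (h.1.mono conv) (h.2.mono conv)
  · simpa using hϑ.2
  · simpa using hϑ.1

lemma aux_charFun {d : ℕ} (P : Measure (EuclideanSpace ℝ (Fin d))) (β : EuclideanSpace ℝ (Fin d)) (r : ℝ) :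
    charFun P (r • β) = charFun (projLaw P β) r := by
  unfold projLaw
  rw [charFun_apply, charFun_apply, integral_map (by fun_prop) (by fun_prop)]
  congr 1
  ext x
  simp [inner_smul_right, real_inner_comm, mul_comm]

lemma aux_prob {d : ℕ} : IsProbabilityMeasure (stdGaussian d) :=
  Measure.isProbabilityMeasure_map (by fun_prop)

lemma aux_openPos {d : ℕ} : (stdGaussian d).IsOpenPosMeasure := by
  have : (gaussianReal 0 1).IsOpenPosMeasure :=
    (gaussianReal_absolutelyContinuous' 0 one_ne_zero).isOpenPosMeasure
  exact (EuclideanSpace.equiv (Fin d) ℝ).symm.continuous.isOpenPosMeasure_map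
    (EuclideanSpace.equiv (Fin d) ℝ).symm.surjective

lemma aux_norm_meas {d : ℕ} :
    Measurable fun x : EuclideanSpace ℝ (Fin d) => ‖x‖⁻¹ • x := by fun_prop

lemma aux_inner_meas_gen {d : ℕ} (G : EuclideanSpace ℝ (Fin d) × ℝ → ℝ) (h1 : Measurable G)
    (M : Measure (EuclideanSpace ℝ (Fin d))) [IsFiniteMeasure M] :
    StronglyMeasurable fun β => ∫ t, G (β, t) ∂(projLaw M β) := by
  have h2 : ∀ β, ∫ t, G (β, t) ∂(projLaw M β) = ∫ x, G (β, ⟪β, x⟫) ∂M := by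
    intro β
    unfold projLaw
    rw [integral_map (by fun_prop)]
    exact (h1.comp measurable_prodMk_left).aestronglyMeasurable
  have h4 : Measurable fun q : EuclideanSpace ℝ (Fin d) × EuclideanSpace ℝ (Fin d) =>
      ((q.1, ⟪q.1, q.2⟫) : EuclideanSpace ℝ (Fin d) × ℝ) := by
    apply Measurable.prodMk measurable_fst
    fun_prop
  have h3 : StronglyMeasurable
      fun q : EuclideanSpace ℝ (Fin d) × EuclideanSpace ℝ (Fin d) => G (q.1, ⟪q.1, q.2⟫) :=
    (h1.comp h4).stronglyMeasurable
  rw [funext h2]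
  exact StronglyMeasurable.integral_prod_right' (ν := M)
    (f := fun q : EuclideanSpace ℝ (Fin d) × EuclideanSpace ℝ (Fin d) => G (q.1, ⟪q.1, q.2⟫)) h3

lemma aux_inner_meas {d : ℕ} (P Q M : Measure (EuclideanSpace ℝ (Fin d))) [IsProbabilityMeasure P]
    [IsProbabilityMeasure Q] [IsFiniteMeasure M] :
    StronglyMeasurable fun β => ∫ t, (projCDF P β t - projCDF Q β t) ^ 2 ∂(projLaw M β) :=
  aux_inner_meas_gen (fun p => (projCDF P p.1 p.2 - projCDF Q p.1 p.2) ^ 2)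
    (((aux_cdf_meas P).sub (aux_cdf_meas Q)).pow_const 2) M

lemma aux_main {d : ℕ} (P Q : Measure (EuclideanSpace ℝ (Fin d)))
    [IsProbabilityMeasure P] [IsProbabilityMeasure Q]
    (ϑ : ℝ) (hϑ : ϑ ∈ Set.Ioo (0 : ℝ) 1) (h : cvmSq ϑ P Q = 0) : P = Q := by
  have := aux_prob (d := d)
  have := aux_openPos (d := d)
  have hU : IsProbabilityMeasure (sphereUniform d) :=
    Measure.isProbabilityMeasure_map aux_norm_meas.aemeasurable
  have hM : IsFiniteMeasure (ENNReal.ofReal ϑ • P + ENNReal.ofReal (1 - ϑ) • Q) := by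
    have := Measure.smul_finite P (c := ENNReal.ofReal ϑ) ENNReal.ofReal_ne_top
    have := Measure.smul_finite Q (c := ENNReal.ofReal (1 - ϑ)) ENNReal.ofReal_ne_top
    infer_instance
  unfold cvmSq at h
  set M := ENNReal.ofReal ϑ • P + ENNReal.ofReal (1 - ϑ) • Q with hMdef
  have hi : Integrable (fun β => ∫ t, (projCDF P β t - projCDF Q β t) ^ 2 ∂(projLaw M β))
      (sphereUniform d) := by
    refine Integrable.of_bound (aux_inner_meas P Q M).aestronglyMeasurable (M.real Set.univ)
      (Filter.Eventually.of_forall fun β => ?_)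
    have : IsFiniteMeasure (projLaw M β) := by
      unfold projLaw
      infer_instance
    refine (norm_integral_le_of_norm_le_const (C := 1)
      (Filter.Eventually.of_forall (aux_bound P Q β))).trans (le_of_eq ?_)
    unfold projLaw
    rw [one_mul, measureReal_def, Measure.map_apply (by fun_prop) MeasurableSet.univ]
    rfl
  rw [integral_eq_zero_iff_of_nonneg (fun β => integral_nonneg fun t => sq_nonneg _) hi] at h
  have hchar : ∀ᵐ x ∂(stdGaussian d), charFun P x = charFun Q x := by
    filter_upwards [ae_of_ae_map aux_norm_meas.aemeasurable h] with x hx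
    have he := aux_proj_eq P Q ϑ hϑ _ hx
    rcases eq_or_ne x 0 with rfl | hx0
    · simp
    · have hs : x = ‖x‖ • (‖x‖⁻¹ • x) := by
        rw [smul_smul, mul_inv_cancel₀ (norm_ne_zero_iff.2 hx0), one_smul]
      rw [hs, aux_charFun, aux_charFun, he]
  apply Measure.ext_of_charFun
  exact Continuous.ae_eq_iff_eq _ continuous_charFun continuous_charFun |>.1 hchar

/-- Characteristic property, Lemma 2.1: for Borel probability measures
`P, Q` on `ℝ^d` and every weight `ϑ ∈ (0,1)`, `W_d²(P,Q) ≥ 0`, and `W_d(P,Q) = 0` iff `P = Q`. -/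
theorem stmt3 {d : ℕ} (P Q : Measure (EuclideanSpace ℝ (Fin d)))
    [IsProbabilityMeasure P] [IsProbabilityMeasure Q]
    (ϑ : ℝ) (hϑ : ϑ ∈ Set.Ioo (0 : ℝ) 1) :
    0 ≤ cvmSq ϑ P Q ∧ (Real.sqrt (cvmSq ϑ P Q) = 0 ↔ P = Q) := by
  have h0 : 0 ≤ cvmSq ϑ P Q := integral_nonneg fun β => integral_nonneg fun t => sq_nonneg _
  refine ⟨h0, fun h => aux_main P Q ϑ hϑ ((Real.sqrt_eq_zero h0).1 h), ?_⟩
  rintro rfl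
  simp [cvmSq]
end
end
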